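/- There is a constant c > 0 such that for all sufficiently large even N the following holds. Let X be a set of N variables, let k be an integer with 1 ≤ k ≤ N^{1/5}, and let S_1 ⊆ S_2 ⊆ ⋯ ⊆ S_ℓ = X be a chain of subsets of X with |S_{i+1}| ≤ 2|S_i| for all 1 ≤ i < ℓ and k < |S_1| ≤ 2k. Then, for φ drawn from D, the probability that no S_i (1 ≤ i ≤ ℓ) is k-unbalanced with respect to φ is at most N^{−c·log N}. -/

import Mathlib

open MvPolynomial

noncomputable section

/-- A multilinear polynomial: every exponent is at most 1. -/
def MLin {σ : Type*} {K : Type*} [CommSemiring K] (f : MvPolynomial σ K) : Prop :=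
  ∀ d ∈ f.support, ∀ i, d i ≤ 1

/-- The partial derivative matrix of a multilinear polynomial over Y ∪ Z
(Y = `inl`-variables, Z = `inr`-variables), rows and columns indexed by subsets. -/
def pdm {h : ℕ} {K : Type*} [CommSemiring K] (f : MvPolynomial (Fin h ⊕ Fin h) K) :
    Matrix (Finset (Fin h)) (Finset (Fin h)) K := fun S T =>
  f.coeff ((∑ i ∈ S, Finsupp.single (Sum.inl i) 1) + ∑ j ∈ T, Finsupp.single (Sum.inr j) 1)

/-- The field G = F(W), the field of rational functions over F in variables
`w_{i,k,j}`, `i,k,j ∈ ℕ`. -/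
abbrev Gf (F : Type*) [Field F] : Type _ := FractionRing (MvPolynomial (ℕ × ℕ × ℕ) F)

/-- The element w_{i,k,j} of G. -/
def wv (F : Type*) [Field F] (i k j : ℕ) : Gf F :=
  algebraMap (MvPolynomial (ℕ × ℕ × ℕ) F) (Gf F) (MvPolynomial.X (i, k, j))

/-- The Raz–Yehudayoff polynomials `g_{i,j}` (first argument is fuel; every
recursive call reduces `j - i` by at least 2, so fuel `N` suffices for `g_{1,N}`). -/
def RY (F : Type*) [Field F] : ℕ → ℕ → ℕ → MvPolynomial ℕ (Gf F)
  | 0, _, _ => 1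
  | fuel + 1, i, j =>
      if j < i then 1
      else (1 + X i * X j) * RY F fuel (i + 1) (j - 1)
        + ∑ k ∈ (Finset.Icc (i + 1) (j - 2)).filter (fun k => (k - i) % 2 = 1),
            C (wv F i k j) * RY F fuel i k * RY F fuel (k + 1) j

/-- The Raz–Yehudayoff polynomial `g = g_{1,N}`, in the variables `x_1, …, x_N`. -/
def razPoly (F : Type*) [Field F] (N : ℕ) : MvPolynomial ℕ (Gf F) := RY F N 1 N

/-- `|φ(S) ∩ Y|` for a partition function φ. -/
def yCount {h : ℕ} (φ : ℕ → Fin h ⊕ Fin h) (S : Finset ℕ) : ℕ :=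
  (S.filter fun x => (φ x).isLeft = true).card

/-- `|φ(S) ∩ Z|` for a partition function φ. -/
def zCount {h : ℕ} (φ : ℕ → Fin h ⊕ Fin h) (S : Finset ℕ) : ℕ :=
  (S.filter fun x => (φ x).isRight = true).card

/-- `S` is `k`-unbalanced with respect to the partition φ. -/
def kUnb {h : ℕ} (φ : ℕ → Fin h ⊕ Fin h) (k : ℕ) (S : Finset ℕ) : Prop :=
  (k : ℤ) ≤ |(yCount φ S : ℤ) - (zCount φ S : ℤ)|

/-- Extension of a partition given on `X` to all of ℕ (junk value elsewhere). -/
def extPart {h : ℕ} (hh : 0 < h) (X : Finset ℕ) (e : {x // x ∈ X} → Fin h ⊕ Fin h) :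
    ℕ → Fin h ⊕ Fin h := fun x =>
  if hx : x ∈ X then e ⟨x, hx⟩ else Sum.inl ⟨0, hh⟩

/-- Probability of an event under the uniform distribution on a finite type. -/
def unifProb {Ω : Type*} [Fintype Ω] (p : Ω → Prop) : ℝ :=
  haveI := Classical.decPred p
  ((Finset.univ.filter p).card : ℝ) / (Fintype.card Ω : ℝ)

/-- The (1,1) entry of the product `M 0 * M 1 * ⋯ * M (n-1)`. -/
def mprodVal {K : Type*} [CommSemiring K] {n w : ℕ} (hw : 0 < w)
    (M : Fin n → Matrix (Fin w) (Fin w) (MvPolynomial ℕ K)) : MvPolynomial ℕ K :=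
  (List.ofFn M).prod ⟨0, hw⟩ ⟨0, hw⟩

/-- An oblivious read-once ABP of width `w` in variables `x_1, …, x_N` with
variable order π (a permutation of `{1, …, N}`): the ℓ-th layer matrix has
entries of degree at most 1 in the single variable `x_{π(ℓ)}`. -/
def IsROABP {K : Type*} [CommSemiring K] (N w : ℕ) (π : ℕ → ℕ)
    (M : Fin N → Matrix (Fin w) (Fin w) (MvPolynomial ℕ K)) : Prop :=
  Set.BijOn π (Set.Icc 1 N) (Set.Icc 1 N) ∧
    ∀ ℓ : Fin N, ∀ i j, ∃ a b : K, M ℓ i j = C a + C b * X (π (ℓ.val + 1))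

/-- An `r`-pass syntactically multilinear ABP of width `w`. -/
def IsRPass {K : Type*} [CommSemiring K] (N w r : ℕ) (π : Fin r → ℕ → ℕ)
    (M : Fin (r * N) → Matrix (Fin w) (Fin w) (MvPolynomial ℕ K)) : Prop :=
  (∀ j, Set.BijOn (π j) (Set.Icc 1 N) (Set.Icc 1 N)) ∧
  (∀ ℓ : Fin (r * N), ∀ i j, ∃ a b : K,
      M ℓ i j = C a + C b *
        X (π ⟨ℓ.val / N, Nat.div_lt_of_lt_mul (by rw [Nat.mul_comm N r]; exact ℓ.2)⟩
            (ℓ.val % N + 1))) ∧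
  (∀ (idx : Fin (r * N + 1) → Fin w) (v : ℕ) (ℓ₁ ℓ₂ : Fin (r * N)),
      v ∈ (M ℓ₁ (idx ℓ₁.castSucc) (idx ℓ₁.succ)).vars →
      v ∈ (M ℓ₂ (idx ℓ₂.castSucc) (idx ℓ₂.succ)).vars → ℓ₁ = ℓ₂)

/-- An α-sparse ROABP with variable blocks `Xs 0, …, Xs (d-1)`, width `w` and
sparsity `t`: every entry of the `i`-th matrix is a multilinear polynomial in the
variables `Xs i` with at most `t` monomials. -/
def IsSparseROABP {K : Type*} [CommSemiring K] {d : ℕ} (w t : ℕ)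
    (Xs : Fin d → Finset ℕ) (M : Fin d → Matrix (Fin w) (Fin w) (MvPolynomial ℕ K)) : Prop :=
  ∀ ℓ i j, MLin (M ℓ i j) ∧ (M ℓ i j).vars ⊆ Xs ℓ ∧ (M ℓ i j).support.card ≤ t
/-- `S ⊆ X` is `k`-unbalanced with respect to a partition given as a map on `X`. -/
def kUnbOn {h : ℕ} (X : Finset ℕ) (e : {x // x ∈ X} → Fin h ⊕ Fin h) (k : ℕ)
    (S : Finset ℕ) : Prop :=
  (k : ℤ) ≤ |((X.attach.filter fun x => x.1 ∈ S ∧ (e x).isLeft = true).card : ℤ) -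
             ((X.attach.filter fun x => x.1 ∈ S ∧ (e x).isRight = true).card : ℤ)|


lemma cb_sq (n : ℕ) : n.centralBinom ^ 2 * (2 * n + 1) ≤ 16 ^ n := by
  induction n with
  | zero => simp
  | succ n ih =>
    have h := Nat.succ_mul_centralBinom_succ n
    have h2 : (n + 1) ^ 2 * ((n + 1).centralBinom ^ 2 * (2 * (n + 1) + 1))
        ≤ (n + 1) ^ 2 * 16 ^ (n + 1) := by
      calc (n + 1) ^ 2 * ((n + 1).centralBinom ^ 2 * (2 * (n + 1) + 1))
          = ((n + 1) * (n + 1).centralBinom) ^ 2 * (2 * (n + 1) + 1) := by ring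
        _ = (n.centralBinom ^ 2 * (2 * n + 1)) * (4 * ((2 * n + 1) * (2 * n + 3))) := by
            rw [h]; ring
        _ ≤ 16 ^ n * (16 * (n + 1) ^ 2) := by
            apply Nat.mul_le_mul ih
            nlinarith
        _ = (n + 1) ^ 2 * 16 ^ (n + 1) := by ring
    exact Nat.le_of_mul_le_mul_left h2 (by positivity)

lemma choose_sq (d j : ℕ) : (d.choose j) ^ 2 * d ≤ 4 ^ d := by
  obtain ⟨n, rfl | rfl⟩ := Nat.even_or_odd' d
  · have h1 := Nat.choose_le_centralBinom j n
    have h2 := cb_sq n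
    calc ((2 * n).choose j) ^ 2 * (2 * n) ≤ n.centralBinom ^ 2 * (2 * n + 1) := by
          gcongr; omega
      _ ≤ 16 ^ n := h2
      _ = 4 ^ (2 * n) := by rw [pow_mul]; norm_num
  · have h2 := cb_sq n
    have h1 : (2 * n + 1).choose j ≤ 2 * n.centralBinom := by
      cases j with
      | zero =>
        have := Nat.centralBinom_pos n
        simp; omega
      | succ j =>
        rw [Nat.choose_succ_succ]
        have := Nat.choose_le_centralBinom j n
        have := Nat.choose_le_centralBinom (j+1) n
        simp only [Nat.succ_eq_add_one]
        omega
    calc ((2 * n + 1).choose j) ^ 2 * (2 * n + 1)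
        ≤ (2 * n.centralBinom) ^ 2 * (2 * n + 1) := by gcongr
      _ = 4 * (n.centralBinom ^ 2 * (2 * n + 1)) := by ring
      _ ≤ 4 * 16 ^ n := by gcongr
      _ = 4 ^ (2 * n + 1) := by rw [pow_succ, pow_mul]; norm_num; ring

/-- few subsets of `D` are nearly balanced -/
lemma near_bal {α : Type*} [DecidableEq α] (D : Finset α) (k m : ℕ)
    (hd : 4 * k ^ 2 * 4 ^ m ≤ D.card) :
    (D.powerset.filter fun A => |2 * (A.card : ℤ) - D.card| < 2 * k).card * 2 ^ m
      ≤ 2 ^ D.card := by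
  set d := D.card with hdd
  set I : Finset ℕ := (Finset.range (d + 1)).filter fun a => |2 * (a : ℤ) - d| < 2 * k with hI
  have hIc : I.card ≤ 2 * k := by
    have : I ⊆ Finset.Ico ((d + 2) / 2 - k) ((d + 2) / 2 - k + 2 * k) := by
      intro a ha
      simp only [hI, Finset.mem_filter, abs_lt] at ha
      simp only [Finset.mem_Ico]
      omega
    simpa using Finset.card_le_card this
  have h1 : (D.powerset.filter fun A => |2 * (A.card : ℤ) - d| < 2 * k)
      ⊆ I.biUnion fun a => D.powersetCard a := by
    intro A hA
    simp only [Finset.mem_filter, Finset.mem_powerset] at hA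
    simp only [Finset.mem_biUnion, Finset.mem_powersetCard, hI, Finset.mem_filter,
      Finset.mem_range]
    have := Finset.card_le_card hA.1
    exact ⟨A.card, ⟨by omega, hA.2⟩, hA.1, rfl⟩
  have h2 : (D.powerset.filter fun A => |2 * (A.card : ℤ) - d| < 2 * k).card
      ≤ 2 * k * d.choose (d / 2) := by
    calc _ ≤ _ := Finset.card_le_card h1
      _ ≤ I.card * d.choose (d / 2) := by
        apply Finset.card_biUnion_le_card_mul
        intro a _
        rw [Finset.card_powersetCard]
        exact Nat.choose_le_middle a d
      _ ≤ _ := by gcongr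
  have h3 := choose_sq d (d / 2)
  refine le_trans (Nat.mul_le_mul_right _ h2) ?_
  rw [← Nat.pow_le_pow_iff_left (n := 2) (by norm_num)]
  calc (2 * k * d.choose (d / 2) * 2 ^ m) ^ 2
      = d.choose (d / 2) ^ 2 * (4 * k ^ 2 * 4 ^ m) := by
        rw [show (4:ℕ) ^ m = (2 ^ m) ^ 2 by rw [← pow_mul, mul_comm, pow_mul]; norm_num]; ring
    _ ≤ d.choose (d / 2) ^ 2 * d := by gcongr
    _ ≤ 4 ^ d := h3
    _ = (2 ^ d) ^ 2 := by rw [← pow_mul, mul_comm, pow_mul]; norm_num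

lemma count_chain {α : Type*} [DecidableEq α] (B : ℕ → Finset α) (k m r : ℕ)
    (hm : ∀ j < r, B j ⊆ B (j + 1))
    (hd : ∀ j < r, 4 * k ^ 2 * 4 ^ m ≤ (B (j + 1) \ B j).card) :
    ((B r).powerset.filter fun A => ∀ j ≤ r,
        |2 * ((A ∩ B j).card : ℤ) - (B j).card| < k).card * 2 ^ (m * r) ≤ 2 ^ (B r).card := by
  induction r with
  | zero =>
    simp only [mul_zero, pow_zero, mul_one]
    exact (Finset.card_filter_le _ _).trans (by simp)
  | succ r ih =>
    have ih := ih (fun j hj => hm j (by omega)) (fun j hj => hd j (by omega))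
    have hmr : ∀ j ≤ r, B j ⊆ B r := by
      intro j hj
      have : ∀ i, j ≤ i → i ≤ r → B j ⊆ B i := by
        intro i hji
        induction i, hji using Nat.le_induction with
        | base => intro _; exact subset_rfl
        | succ i hi ih2 => intro hh; exact (ih2 (by omega)).trans (hm i (by omega))
      exact this r hj le_rfl
    have hnb := near_bal (B (r + 1) \ B r) k m (hd r (by omega))
    set F := ((B r).powerset.filter fun A => ∀ j ≤ r,
        |2 * ((A ∩ B j).card : ℤ) - (B j).card| < k) with hF
    set G := ((B (r+1) \ B r).powerset.filter fun A =>
      |2 * (A.card : ℤ) - (B (r+1) \ B r).card| < 2 * k) with hG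
    have hcard := Finset.card_sdiff_add_card_eq_card (hm r (by omega))
    have key : ((B (r+1)).powerset.filter fun A => ∀ j ≤ r + 1,
        |2 * ((A ∩ B j).card : ℤ) - (B j).card| < k).card ≤ (F ×ˢ G).card := by
      apply Finset.card_le_card_of_injOn (fun A => (A ∩ B r, A \ B r))
      · intro A hA
        simp only [Finset.coe_filter, Finset.mem_powerset, Set.mem_ofPred_eq] at hA
        obtain ⟨hA, hb⟩ := hA
        simp only [Finset.coe_product, Set.mem_prod, Finset.mem_coe, hF, hG, Finset.mem_filter,
          Finset.mem_powerset]
        refine ⟨⟨Finset.inter_subset_right, fun j hj => ?_⟩,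
          Finset.sdiff_subset_sdiff hA subset_rfl, ?_⟩
        · rw [Finset.inter_assoc, Finset.inter_eq_right.2 (hmr j hj)]
          exact hb j (by omega)
        · have h1 := hb r (by omega)
          have h2 := hb (r + 1) le_rfl
          rw [Finset.inter_eq_left.2 hA] at h2
          have h3 := Finset.card_inter_add_card_sdiff A (B r)
          rw [abs_lt] at *
          omega
      · intro A _ A' _ h
        simp only [Prod.mk.injEq] at h
        rw [← Finset.sdiff_union_inter A (B r), h.1, h.2, Finset.sdiff_union_inter]
    calc _ ≤ (F ×ˢ G).card * 2 ^ (m * (r + 1)) := Nat.mul_le_mul_right _ key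
      _ = (F.card * 2 ^ (m * r)) * (G.card * 2 ^ m) := by
        rw [Finset.card_product]; ring
      _ ≤ 2 ^ (B r).card * 2 ^ (B (r + 1) \ B r).card := Nat.mul_le_mul ih hnb
      _ = _ := by rw [← pow_add, ← hcard, add_comm]

lemma count_univ {α : Type*} [DecidableEq α] [Fintype α] (B : ℕ → Finset α) (k m r : ℕ)
    (hm : ∀ j < r, B j ⊆ B (j + 1))
    (hd : ∀ j < r, 4 * k ^ 2 * 4 ^ m ≤ (B (j + 1) \ B j).card) :
    ((Finset.univ : Finset (Finset α)).filter fun A => ∀ j ≤ r,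
        |2 * ((A ∩ B j).card : ℤ) - (B j).card| < k).card * 2 ^ (m * r)
        ≤ 2 ^ Fintype.card α := by
  have h := count_chain B k m r hm hd
  have hmr : ∀ j ≤ r, B j ⊆ B r := by
    intro j hj
    have : ∀ i, j ≤ i → i ≤ r → B j ⊆ B i := by
      intro i hji
      induction i, hji using Nat.le_induction with
      | base => intro _; exact subset_rfl
      | succ i hi ih2 => intro hh; exact (ih2 (by omega)).trans (hm i (by omega))
    exact this r hj le_rfl
  set F := ((B r).powerset.filter fun A => ∀ j ≤ r,
        |2 * ((A ∩ B j).card : ℤ) - (B j).card| < k) with hF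
  have key : ((Finset.univ : Finset (Finset α)).filter fun A => ∀ j ≤ r,
        |2 * ((A ∩ B j).card : ℤ) - (B j).card| < k).card
        ≤ (F ×ˢ (B r)ᶜ.powerset).card := by
    apply Finset.card_le_card_of_injOn (fun A => (A ∩ B r, A \ B r))
    · intro A hA
      simp only [Finset.coe_filter, Finset.mem_univ, true_and, Set.mem_ofPred_eq] at hA
      simp only [Finset.coe_product, Set.mem_prod, Finset.mem_coe, hF, Finset.mem_filter,
          Finset.mem_powerset]
      refine ⟨⟨Finset.inter_subset_right, fun j hj => ?_⟩, ?_⟩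
      · rw [Finset.inter_assoc, Finset.inter_eq_right.2 (hmr j hj)]
        exact hA j hj
      · intro x hx
        simp at hx ⊢
        exact hx.2
    · intro A _ A' _ h
      simp only [Prod.mk.injEq] at h
      rw [← Finset.sdiff_union_inter A (B r), h.1, h.2, Finset.sdiff_union_inter]
  calc _ ≤ (F ×ˢ (B r)ᶜ.powerset).card * 2 ^ (m * r) := Nat.mul_le_mul_right _ key
    _ = (F.card * 2 ^ (m * r)) * 2 ^ ((B r)ᶜ).card := by
        rw [Finset.card_product, Finset.card_powerset]; ring
    _ ≤ 2 ^ (B r).card * 2 ^ ((B r)ᶜ).card := Nat.mul_le_mul_right _ h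
    _ = _ := by rw [← pow_add, Finset.card_add_card_compl]

/-- the set of elements sent to the left side -/
def leftSet {α : Type*} [Fintype α] {h : ℕ} (e : α ≃ (Fin h ⊕ Fin h)) : Finset α :=
  Finset.univ.filter fun x => (e x).isLeft = true

lemma fiber_le {α : Type*} [Fintype α] [DecidableEq α] {h : ℕ} (A : Finset α) :
    ((Finset.univ : Finset (α ≃ (Fin h ⊕ Fin h))).filter fun e => leftSet e = A).card
      ≤ h.factorial ^ 2 := by
  classical
  by_cases hne : ∃ e0 : α ≃ (Fin h ⊕ Fin h), leftSet e0 = A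
  · obtain ⟨e0, he0⟩ := hne
    have : ((Finset.univ : Finset (α ≃ (Fin h ⊕ Fin h))).filter fun e => leftSet e = A).card
      ≤ (Finset.univ.image (fun p : Equiv.Perm (Fin h) × Equiv.Perm (Fin h) =>
          Equiv.Perm.sumCongrHom (Fin h) (Fin h) p)).card := by
      apply Finset.card_le_card_of_injOn (fun e => e0.symm.trans e)
      · intro e he
        simp only [Finset.coe_filter, Finset.mem_univ, true_and, Set.mem_ofPred_eq] at he
        have : (e0.symm.trans e : Equiv.Perm (Fin h ⊕ Fin h)) ∈
            (Equiv.Perm.sumCongrHom (Fin h) (Fin h)).range := by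
          apply Equiv.Perm.mem_sumCongrHom_range_of_perm_mapsTo_inl
          rintro _ ⟨a, rfl⟩
          have h1 : e0.symm (Sum.inl a) ∈ leftSet e0 := by simp [leftSet]
          rw [he0, ← he] at h1
          simp only [leftSet, Finset.mem_filter, Finset.mem_univ, true_and,
            Sum.isLeft_iff] at h1
          obtain ⟨y, hy⟩ := h1
          exact ⟨y, by simp [hy]⟩
        obtain ⟨p, hp⟩ := this
        simp only [Finset.coe_image, Finset.coe_univ, Set.image_univ, Set.mem_range]
        exact ⟨p, hp⟩
      · intro e _ e' _ hh
        ext1 x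
        have := congrArg (fun g : Equiv.Perm (Fin h ⊕ Fin h) => g (e0 x)) hh
        simpa using this
    refine this.trans (Finset.card_image_le.trans ?_)
    simp [Fintype.card_perm, sq]
  · push Not at hne
    simp [hne]

/-- the probability bound, combinatorial form -/
lemma prob_le {α : Type*} [Fintype α] [DecidableEq α] {h : ℕ} (hh : 0 < h)
    (hα : Fintype.card α = 2 * h)
    (B : ℕ → Finset α) (k m r : ℕ)
    (hm : ∀ j < r, B j ⊆ B (j + 1))
    (hd : ∀ j < r, 4 * k ^ 2 * 4 ^ m ≤ (B (j + 1) \ B j).card)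
    (p : (α ≃ (Fin h ⊕ Fin h)) → Prop)
    (hp : ∀ e, p e → ∀ j ≤ r, |2 * ((leftSet e ∩ B j).card : ℤ) - (B j).card| < k) :
    unifProb p ≤ (2 * h : ℝ) / 2 ^ (m * r) := by
  classical
  unfold unifProb
  have hc := count_univ B k m r hm hd
  set 𝒜 := ((Finset.univ : Finset (Finset α)).filter fun A => ∀ j ≤ r,
        |2 * ((A ∩ B j).card : ℤ) - (B j).card| < k) with h𝒜
  have h1 : ((Finset.univ : Finset (α ≃ (Fin h ⊕ Fin h))).filter p).card
      ≤ h.factorial ^ 2 * 𝒜.card := by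
    refine (Finset.card_le_mul_card_image (f := leftSet) _ (h.factorial ^ 2) ?_).trans ?_
    · intro A _
      refine le_trans (Finset.card_le_card ?_) (fiber_le (h := h) A)
      intro e he
      simp at he ⊢
      exact he.2
    · gcongr
      intro A hA
      simp only [Finset.mem_image, Finset.mem_filter, Finset.mem_univ, true_and] at hA
      obtain ⟨e, he, rfl⟩ := hA
      simp only [h𝒜, Finset.mem_filter, Finset.mem_univ, true_and]
      exact hp e he
  have e1 : α ≃ (Fin h ⊕ Fin h) := Fintype.equivOfCardEq (by simp [hα]; ring)
  have h2 : Fintype.card (α ≃ (Fin h ⊕ Fin h)) = (2 * h).factorial := by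
    rw [Fintype.card_equiv e1, hα]
  have h3 : h.factorial ^ 2 * h.centralBinom = (2 * h).factorial := by
    have := Nat.choose_mul_factorial_mul_factorial (n := 2 * h) (k := h) (by omega)
    rw [show 2 * h - h = h by omega] at this
    rw [Nat.centralBinom_eq_two_mul_choose, ← this]; ring
  have h4 := Nat.four_pow_le_two_mul_self_mul_centralBinom h hh
  rw [hα, pow_mul 2 2 h, show (2:ℕ) ^ 2 = 4 by norm_num] at hc
  have h5 : ((Finset.univ : Finset (α ≃ (Fin h ⊕ Fin h))).filter p).card * 2 ^ (m * r)
      ≤ (2 * h) * (2 * h).factorial := by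
    calc _ ≤ h.factorial ^ 2 * 𝒜.card * 2 ^ (m * r) := Nat.mul_le_mul_right _ h1
      _ = h.factorial ^ 2 * (𝒜.card * 2 ^ (m * r)) := by ring
      _ ≤ h.factorial ^ 2 * (2 * h * h.centralBinom) := by
        apply Nat.mul_le_mul_left
        exact hc.trans h4
      _ = _ := by rw [← h3]; ring
  rw [h2, div_le_div_iff₀ (by exact_mod_cast Nat.factorial_pos _) (by positivity)]
  have h6 : (((Finset.univ : Finset (α ≃ (Fin h ⊕ Fin h))).filter p).card : ℝ) * 2 ^ (m * r)
      ≤ (2 * h) * ((2 * h).factorial : ℝ) := by exact_mod_cast h5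
  convert h6

lemma kUnbOn_iff {h : ℕ} (X : Finset ℕ) (e : {x // x ∈ X} ≃ (Fin h ⊕ Fin h)) (k : ℕ)
    (S : Finset ℕ) (hn : ¬ kUnbOn X (fun x => e x) k S) :
    |2 * ((leftSet e ∩ Finset.subtype (· ∈ X) S).card : ℤ)
      - (Finset.subtype (· ∈ X) S).card| < k := by
  classical
  unfold kUnbOn at hn
  push Not at hn
  have h1 : (X.attach.filter fun x => x.1 ∈ S ∧ (e x).isLeft = true)
      = leftSet e ∩ Finset.subtype (· ∈ X) S := by
    ext x; simp [leftSet, and_comm]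
  have h2 : (X.attach.filter fun x => x.1 ∈ S ∧ (e x).isRight = true)
      = Finset.subtype (· ∈ X) S \ leftSet e := by
    ext x; simp [leftSet]
  rw [h1, h2] at hn
  have h3 := Finset.card_inter_add_card_sdiff (Finset.subtype (· ∈ X) S) (leftSet e)
  rw [Finset.inter_comm] at h3
  rw [abs_lt] at hn ⊢
  omega

lemma exists_index (ℓ : ℕ) (hl : 0 < ℓ) (f : Fin ℓ → ℕ) (v : ℕ)
    (hf : ∀ (i : ℕ) (hi : i + 1 < ℓ) (hi' : i < ℓ), f ⟨i + 1, hi⟩ ≤ 2 * f ⟨i, hi'⟩)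
    (h0 : f ⟨0, hl⟩ < v) (hl' : ℓ - 1 < ℓ) (h1 : v ≤ f ⟨ℓ - 1, hl'⟩) :
    ∃ i, v ≤ f i ∧ f i < 2 * v := by
  classical
  have hex : ∃ i, ∃ hi : i < ℓ, v ≤ f ⟨i, hi⟩ := ⟨ℓ - 1, hl', h1⟩
  obtain ⟨hi, hv⟩ := Nat.find_spec hex
  have hmin := fun j => Nat.find_min hex (m := j)
  generalize Nat.find hex = i at hi hv hmin
  rcases i with _ | j
  · omega
  · refine ⟨⟨j + 1, hi⟩, hv, ?_⟩
    have h2 := hmin j (by omega)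
    push Not at h2
    have h3 := h2 (by omega)
    have h4 := hf j hi (by omega)
    omega

lemma two_mul_lt (k : ℕ) (hk : 1 ≤ k) : 2 * k < 4 * k ^ 2 := by nlinarith

lemma exists_thr (m : ℕ) : ∃ N₀ : ℕ, ∀ N, N₀ ≤ N → 0 < N ∧ m ≤ Nat.log 2 N :=
  ⟨2 ^ m, fun _ hN => ⟨lt_of_lt_of_le (Nat.pow_pos (by norm_num)) hN,
    Nat.le_log_of_pow_le (by norm_num) hN⟩⟩

lemma final_bound (N M : ℕ) (hNpos : 0 < N) (hM : 50 ≤ M) (hup : N ≤ 2 ^ (40 * M + 40)) :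
    (N : ℝ) / 2 ^ (M * (9 * M)) ≤ (N : ℝ) ^ (-(1 / 800 * Real.logb 2 N)) := by
  have hNR : (0:ℝ) < N := by exact_mod_cast hNpos
  rw [div_le_iff₀ (by positivity)]
  set x := Real.logb 2 N with hx
  have hNx : (N : ℝ) = (2:ℝ) ^ x := by
    rw [hx, Real.rpow_logb (by norm_num) (by norm_num) hNR]
  have hMR : (50 : ℝ) ≤ M := by exact_mod_cast hM
  have hx1 : x ≤ 40 * M + 40 := by
    rw [hx, Real.logb_le_iff_le_rpow (by norm_num) hNR]
    have : (N : ℝ) ≤ (2:ℝ) ^ (40 * M + 40) := by exact_mod_cast hup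
    rw [← Real.rpow_natCast] at this
    push_cast at this
    exact this
  have hx0 : 0 ≤ x := Real.logb_nonneg (by norm_num) (by exact_mod_cast hNpos)
  have e2 : ((2:ℝ) ^ (M * (9 * M))) = (2:ℝ) ^ ((M : ℝ) * (9 * M)) := by
    rw [← Real.rpow_natCast]; push_cast; rfl
  rw [e2, hNx, ← Real.rpow_mul (by norm_num), ← Real.rpow_add (by norm_num)]
  apply Real.rpow_le_rpow_of_exponent_le (by norm_num)
  have hxx : x * x ≤ (40 * M + 40) * (40 * M + 40) := by
    apply mul_le_mul hx1 hx1 hx0 (by positivity)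
  have hM2 : 50 * (M : ℝ) ≤ (M : ℝ) * M := mul_le_mul_of_nonneg_right hMR (by linarith)
  linarith

/-- A fixed central signature is k-unbalanced with high probability. -/
theorem central_signature_unbalanced :
    ∃ c : ℝ, 0 < c ∧ ∃ N₀ : ℕ, ∀ (N h : ℕ), N₀ ≤ N → N = 2 * h →
      ∀ (X : Finset ℕ), X.card = N →
      ∀ (k : ℕ), 1 ≤ k → (k : ℝ) ≤ (N : ℝ) ^ ((1 : ℝ)/5) →
      ∀ (ℓ : ℕ) (hl : 0 < ℓ) (S : Fin ℓ → Finset ℕ),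
        (∀ i j : Fin ℓ, i ≤ j → S i ⊆ S j) →
        (∀ (i : ℕ) (hi : i + 1 < ℓ), (S ⟨i + 1, hi⟩).card ≤ 2 * (S ⟨i, by omega⟩).card) →
        S ⟨ℓ - 1, by omega⟩ = X →
        k < (S ⟨0, hl⟩).card → (S ⟨0, hl⟩).card ≤ 2 * k →
        unifProb (fun e : {x // x ∈ X} ≃ (Fin h ⊕ Fin h) =>
            ∀ i, ¬ kUnbOn X (fun x => e x) k (S i)) ≤
          (N : ℝ) ^ (-(c * Real.logb 2 N)) := by
  obtain ⟨N₀, hN₀⟩ := exists_thr 2000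
  refine ⟨1 / 800, by norm_num, N₀, ?_⟩
  intro N h hN hNh X hX k hk hkN ℓ hl S hmono hdbl hlast hk0 hk1
  obtain ⟨hNpos, hL3⟩ := hN₀ N hN
  obtain ⟨M, hMdef⟩ : ∃ M, M = Nat.log 2 N / 40 := ⟨_, rfl⟩
  have hL1 : 2 ^ Nat.log 2 N ≤ N := Nat.pow_log_le_self 2 hNpos.ne'
  have hL2 : N < 2 ^ (Nat.log 2 N + 1) := Nat.lt_pow_succ_log_self (by norm_num) N
  have hM : 50 ≤ M := by omega
  have hlow : 2 ^ (40 * M) ≤ N := le_trans (Nat.pow_le_pow_right (by norm_num) (by omega)) hL1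
  have hup : N ≤ 2 ^ (40 * M + 40) :=
    le_trans hL2.le (Nat.pow_le_pow_right (by norm_num) (by omega))
  have hkb : k ≤ 2 ^ (8 * M + 8) := by
    have h5 : (k : ℝ) ^ (5 : ℕ) ≤ (N : ℝ) := by
      calc (k : ℝ) ^ (5 : ℕ) ≤ ((N : ℝ) ^ ((1 : ℝ)/5)) ^ (5 : ℕ) := by gcongr
        _ = (N : ℝ) := by
          rw [← Real.rpow_natCast, ← Real.rpow_mul (by positivity)]; norm_num
    have h5' : k ^ 5 ≤ N := by exact_mod_cast h5
    rw [← Nat.pow_le_pow_iff_left (n := 5) (by norm_num), ← pow_mul]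
    exact (h5'.trans hup).trans (Nat.pow_le_pow_right (by norm_num) (by omega))
  have hk2 : 4 * k ^ 2 * 4 ^ M ≤ 4 ^ (10 * M) := by
    calc 4 * k ^ 2 * 4 ^ M ≤ 4 * (2 ^ (8 * M + 8)) ^ 2 * 4 ^ M := by gcongr
      _ = 4 ^ (9 * M + 9) := by
        rw [← pow_mul, mul_comm (8 * M + 8) 2, pow_mul]; norm_num; ring
      _ ≤ 4 ^ (10 * M) := Nat.pow_le_pow_right (by norm_num) (by omega)
  have hk3 : 2 * k < 4 ^ (10 * M) := by
    refine lt_of_lt_of_le ?_ hk2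
    have h1 : 1 ≤ 4 ^ M := Nat.one_le_pow _ _ (by norm_num)
    have h2 : 2 * k < 4 * k ^ 2 := two_mul_lt k hk
    exact lt_of_lt_of_le h2 (Nat.le_mul_of_pos_right _ h1)
  have hidx : ∀ j : ℕ, ∃ i : Fin ℓ, j ≤ 9 * M →
      4 ^ (10 * M + j) ≤ (S i).card ∧ (S i).card < 2 * 4 ^ (10 * M + j) := by
    intro j
    by_cases hj : j ≤ 9 * M
    · obtain ⟨i, hi⟩ := exists_index ℓ hl (fun i => (S i).card) (4 ^ (10 * M + j)) (fun i hi _ => hdbl i hi)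
        (lt_of_le_of_lt hk1 (lt_of_lt_of_le hk3 (Nat.pow_le_pow_right (by norm_num) (by omega))))
        (by omega) (by
          simp only [hlast, hX]
          refine le_trans ?_ hlow
          rw [show (4:ℕ) = 2 ^ 2 by norm_num, ← pow_mul]
          exact Nat.pow_le_pow_right (by norm_num) (by omega))
      exact ⟨i, fun _ => hi⟩
    · exact ⟨⟨0, hl⟩, fun h => absurd h hj⟩
  choose idx hidx using hidx
  have hsub : ∀ i, S i ⊆ X := by
    intro i
    rw [← hlast]
    exact hmono _ _ (by rw [Fin.le_def]; simp; omega)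
  have hchain : ∀ j < 9 * M, S (idx j) ⊆ S (idx (j + 1)) := by
    intro j hj
    apply hmono
    by_contra hcon
    push Not at hcon
    have h1 := Finset.card_le_card (hmono _ _ hcon.le)
    have h2 := (hidx j (by omega)).2
    have h3 := (hidx (j + 1) (by omega)).1
    rw [← add_assoc, pow_succ] at h3
    omega
  have hscard : ∀ i, (Finset.subtype (· ∈ X) (S i)).card = (S i).card := by
    intro i
    rw [Finset.card_subtype, Finset.filter_true_of_mem (fun x hx => hsub i hx)]
  have hprob := prob_le (α := {x // x ∈ X}) (h := h) (by omega) (by simp [hX, hNh])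
    (fun j => Finset.subtype (· ∈ X) (S (idx j))) k M (9 * M)
    (by
      intro j hj x hx
      simp only [Finset.mem_subtype] at hx ⊢
      exact hchain j hj hx)
    (by
      intro j hj
      have hs : Finset.subtype (· ∈ X) (S (idx j)) ⊆ Finset.subtype (· ∈ X) (S (idx (j+1))) := by
        intro x hx
        simp only [Finset.mem_subtype] at hx ⊢
        exact hchain j hj hx
      have h0 := Finset.card_sdiff_add_card_eq_card hs
      rw [hscard, hscard] at h0
      have h2 := (hidx j (by omega)).2
      have h3 := (hidx (j + 1) (by omega)).1
      rw [← add_assoc, pow_succ] at h3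
      have h4 : 4 ^ (10 * M) ≤ 4 ^ (10 * M + j) := Nat.pow_le_pow_right (by norm_num) (by omega)
      omega)
    (fun e => ∀ i, ¬ kUnbOn X (fun x => e x) k (S i))
    (fun e he j _ => kUnbOn_iff X e k _ (he (idx j)))
  refine hprob.trans ?_
  have h2h : (2 * h : ℝ) = N := by rw [hNh]; push_cast; ring
  rw [h2h]
  exact final_bound N M hNpos hM hup

end
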